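/- Let n ≥ 2 and let k be a nonzero integer. Any two distinct elements u, v of X have a least upper bound u ∨ v in the poset ([1,λ^k], ⪯) (i.e. an element of [1,λ^k] that is a ⪯-multiple of both and that ⪯-divides every element of [1,λ^k] that is a common ⪯-multiple of u and v), given by: t_i ∨ t_j = t_i·t_{i−k} = t_j·t_{j−k} for i ≠ j ∈ ℤ; t_i ∨ s_3 = t_i·s_3·t_i = s_3·t_i·s_3 for i ∈ ℤ; t_i ∨ s_j = t_i·s_j = s_j·t_i for i ∈ ℤ and 4 ≤ j ≤ n; s_i ∨ s_{i+1} = s_i·s_{i+1}·s_i = s_{i+1}·s_i·s_{i+1} for 3 ≤ i ≤ n−1; s_i ∨ s_j = s_i·s_j = s_j·s_i for 3 ≤ i ≠ j ≤ n with |i−j| > 1. -/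

import Mathlib

/-- The indeterminate `x` in the field `K = ℚ(x)` of rational functions over `ℚ`. -/
noncomputable def xx : RatFunc ℚ := RatFunc.X

/-- Membership in `G(∞,∞,n)`: a monomial matrix whose nonzero entries are integer powers
of `x` and such that the product of the nonzero entries is `1`. -/
def IsGinf (n : ℕ) (w : Matrix (Fin n) (Fin n) (RatFunc ℚ)) : Prop :=
  (∀ i : Fin n, ∃! c : Fin n, w i c ≠ 0) ∧
  (∀ c : Fin n, ∃! i : Fin n, w i c ≠ 0) ∧
  (∀ i c : Fin n, w i c ≠ 0 → ∃ k : ℤ, w i c = xx ^ k) ∧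
  (∏ i : Fin n, ∑ c : Fin n, w i c) = 1

/-- The generator `t_i` (1-indexed rows/columns 1,2 are `Fin` indices 0,1). -/
noncomputable def tMat (n : ℕ) (i : ℤ) : Matrix (Fin n) (Fin n) (RatFunc ℚ) :=
  fun r c =>
    if r.val = 0 ∧ c.val = 1 then xx ^ (-i)
    else if r.val = 1 ∧ c.val = 0 then xx ^ i
    else if r = c ∧ 2 ≤ r.val then 1 else 0

/-- The generator `s_j` (`3 ≤ j ≤ n`): permutation matrix of the transposition exchanging
coordinates `j-1` and `j` (1-indexed), i.e. `Fin` indices `j-2` and `j-1`. -/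
noncomputable def sMat (n : ℕ) (j : ℕ) : Matrix (Fin n) (Fin n) (RatFunc ℚ) :=
  fun r c =>
    if (r.val + 2 = j ∧ c.val + 1 = j) ∨ (r.val + 1 = j ∧ c.val + 2 = j) ∨
       (r = c ∧ r.val + 2 ≠ j ∧ r.val + 1 ≠ j) then 1 else 0

/-- The generating set `X = {t_i : i ∈ ℤ} ∪ {s_j : 3 ≤ j ≤ n}`. -/
def Xset (n : ℕ) : Set (Matrix (Fin n) (Fin n) (RatFunc ℚ)) :=
  {w | (∃ i : ℤ, w = tMat n i) ∨ (∃ j : ℕ, 3 ≤ j ∧ j ≤ n ∧ w = sMat n j)}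

/-- `len n w` is the minimal `m` such that `w` is a product of `m` elements of `X`. -/
noncomputable def len (n : ℕ) (w : Matrix (Fin n) (Fin n) (RatFunc ℚ)) : ℕ :=
  sInf {m | ∃ L : List (Matrix (Fin n) (Fin n) (RatFunc ℚ)),
    L.length = m ∧ (∀ a ∈ L, a ∈ Xset n) ∧ L.prod = w}

/-- Left divisibility: `v ⪯ w` iff `ℓ(v) + ℓ(v⁻¹ w) = ℓ(w)`. -/
def preL (n : ℕ) (v w : Matrix (Fin n) (Fin n) (RatFunc ℚ)) : Prop :=
  len n v + len n (v⁻¹ * w) = len n w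

/-- Right divisibility: `v ⪯_r w` iff `ℓ(w v⁻¹) + ℓ(v) = ℓ(w)`. -/
def preR (n : ℕ) (v w : Matrix (Fin n) (Fin n) (RatFunc ℚ)) : Prop :=
  len n (w * v⁻¹) + len n v = len n w

/-- The element `λ = diag(x^{-(n-1)}, x, …, x)`. -/
noncomputable def lam (n : ℕ) : Matrix (Fin n) (Fin n) (RatFunc ℚ) :=
  Matrix.diagonal (fun i => if i.val = 0 then xx ^ (-((n : ℤ) - 1)) else xx)

/-- The interval `[1, λ^k]` of left divisors of `λ^k`. -/
noncomputable def intervalL (n : ℕ) (k : ℤ) : Set (Matrix (Fin n) (Fin n) (RatFunc ℚ)) :=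
  {v | preL n v ((lam n) ^ k)}

/-- The interval `[1, λ^k]_r` of right divisors of `λ^k`. -/
noncomputable def intervalR (n : ℕ) (k : ℤ) : Set (Matrix (Fin n) (Fin n) (RatFunc ℚ)) :=
  {v | preR n v ((lam n) ^ k)}

/-- `m` is a least upper bound of `u` and `v` in the poset `([1,λ^k], ⪯)`. -/
noncomputable def IsLubL (n : ℕ) (k : ℤ)
    (u v m : Matrix (Fin n) (Fin n) (RatFunc ℚ)) : Prop :=
  m ∈ intervalL n k ∧ preL n u m ∧ preL n v m ∧
    ∀ z ∈ intervalL n k, preL n u z → preL n v z → preL n m z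

/-- `m` is a least upper bound of `u` and `v` in the poset `([1,λ^k]_r, ⪯_r)`. -/
noncomputable def IsLubR (n : ℕ) (k : ℤ)
    (u v m : Matrix (Fin n) (Fin n) (RatFunc ℚ)) : Prop :=
  m ∈ intervalR n k ∧ preR n u m ∧ preR n v m ∧
    ∀ z ∈ intervalR n k, preR n u z → preR n v z → preR n m z

open Matrix Finset

lemma xx_ne_zero : xx ≠ 0 := RatFunc.X_ne_zero

lemma xx_zpow_injective : Function.Injective fun a : ℤ => xx ^ a := by
  have hnat : ∀ m : ℕ, xx ^ m = 1 → m = 0 := by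
    intro m hm
    have h : algebraMap (Polynomial ℚ) (RatFunc ℚ) (Polynomial.X ^ m) = algebraMap _ _ 1 := by
      rw [map_pow, RatFunc.algebraMap_X, map_one]
      exact hm
    have h' := congrArg Polynomial.natDegree (RatFunc.algebraMap_injective ℚ h)
    simpa using h'
  intro a b hab
  have h1 : xx ^ (a - b) = 1 := by
    rw [zpow_sub₀ xx_ne_zero]
    exact (div_eq_one_iff_eq (zpow_ne_zero _ xx_ne_zero)).2 hab
  have h2 : xx ^ (a - b).natAbs = 1 := by
    rcases Int.natAbs_eq (a - b) with h | h
    · rw [h, zpow_natCast] at h1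
      exact h1
    · rw [h, _root_.zpow_neg, zpow_natCast, inv_eq_one] at h1
      exact h1
  have h3 := hnat _ h2
  omega

/-- The monomial matrix whose nonzero entry in row `r` is `x ^ a r`, in column `σ r`. -/
noncomputable def monomialMat {n : ℕ} (a : Fin n → ℤ) (σ : Equiv.Perm (Fin n)) :
    Matrix (Fin n) (Fin n) (RatFunc ℚ) :=
  fun r c => if σ r = c then xx ^ a r else 0

section Monomial

variable {n : ℕ}

lemma monomialMat_mul (a b : Fin n → ℤ) (σ τ : Equiv.Perm (Fin n)) :
    monomialMat a σ * monomialMat b τ = monomialMat (fun r => a r + b (σ r)) (τ * σ) := by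
  ext r c
  rw [Matrix.mul_apply, Finset.sum_eq_single (σ r)]
  · simp [monomialMat, zpow_add₀ xx_ne_zero]
  · intro j _ hj
    simp [monomialMat, hj.symm]
  · simp

lemma monomialMat_zero_one : monomialMat (0 : Fin n → ℤ) 1 = 1 := by
  ext r c
  simp [monomialMat, Matrix.one_apply]

lemma monomialMat_inj {a b : Fin n → ℤ} {σ τ : Equiv.Perm (Fin n)}
    (h : monomialMat a σ = monomialMat b τ) : a = b ∧ σ = τ := by
  have hσ : σ = τ := by
    ext r
    by_contra hne
    have h1 := congrFun (congrFun h r) (σ r)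
    rw [monomialMat, monomialMat, if_pos rfl, if_neg (fun h' => hne (by rw [h']))] at h1
    exact zpow_ne_zero _ xx_ne_zero h1
  subst hσ
  refine ⟨funext fun r => xx_zpow_injective ?_, rfl⟩
  simpa [monomialMat] using congrFun (congrFun h r) (σ r)

lemma monomialMat_inv (a : Fin n → ℤ) (σ : Equiv.Perm (Fin n)) :
    (monomialMat a σ)⁻¹ = monomialMat (fun r => -a (σ⁻¹ r)) σ⁻¹ := by
  refine Matrix.inv_eq_left_inv ?_
  rw [monomialMat_mul, ← monomialMat_zero_one, mul_inv_cancel]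
  congr 1
  ext r
  simp

lemma isUnit_det_monomialMat (a : Fin n → ℤ) (σ : Equiv.Perm (Fin n)) :
    IsUnit (monomialMat a σ).det := by
  refine Matrix.isUnit_det_of_left_inverse (B := monomialMat (fun r => -a (σ⁻¹ r)) σ⁻¹) ?_
  rw [monomialMat_mul, ← monomialMat_zero_one, mul_inv_cancel]
  congr 1
  ext r
  simp

/-- The contribution of a pair of rows `i < j` to the length of a monomial matrix. -/
def pairWeight (a : Fin n → ℤ) (σ : Equiv.Perm (Fin n)) (i j : Fin n) : ℕ :=
  if σ j < σ i then 1 else if a j = 0 then 0 else 2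

/-- The pairs of rows, the upper one first. -/
def rowPairs (n : ℕ) : Finset (Fin n × Fin n) := univ.filter fun ij => ij.1 < ij.2

/-- The combinatorial length of a monomial matrix. -/
def weight (a : Fin n → ℤ) (σ : Equiv.Perm (Fin n)) : ℕ :=
  ∑ ij ∈ rowPairs n, pairWeight a σ ij.1 ij.2

lemma mem_rowPairs {ij : Fin n × Fin n} : ij ∈ rowPairs n ↔ ij.1 < ij.2 := by
  simp [rowPairs]

/-- Exponents of the generator acting on the rows `p` and `q`. -/
def shift (p q : Fin n) (i : ℤ) (r : Fin n) : ℤ :=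
  if r = p then -i else if r = q then i else 0

/-- The generator acting on the adjacent rows `p` and `q`, twisted by `x ^ i`. -/
noncomputable def gen (p q : Fin n) (i : ℤ) : Matrix (Fin n) (Fin n) (RatFunc ℚ) :=
  monomialMat (shift p q i) (Equiv.swap p q)

/-- The row exponents after multiplying by `gen p q i` on the left. -/
def genAct (p q : Fin n) (i : ℤ) (a : Fin n → ℤ) (r : Fin n) : ℤ :=
  shift p q i r + a (Equiv.swap p q r)

lemma gen_mul_monomialMat (p q : Fin n) (i : ℤ) (a : Fin n → ℤ) (σ : Equiv.Perm (Fin n)) :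
    gen p q i * monomialMat a σ = monomialMat (genAct p q i a) (σ * Equiv.swap p q) :=
  monomialMat_mul _ _ _ _

lemma genAct_left (p q : Fin n) (i : ℤ) (a : Fin n → ℤ) : genAct p q i a p = a q - i := by
  simp [genAct, shift]
  ring

lemma genAct_right {p q : Fin n} (h : p ≠ q) (i : ℤ) (a : Fin n → ℤ) :
    genAct p q i a q = a p + i := by
  simp [genAct, shift, h.symm]
  ring

lemma genAct_of_ne {p q r : Fin n} (hp : r ≠ p) (hq : r ≠ q) (i : ℤ) (a : Fin n → ℤ) :
    genAct p q i a r = a r := by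
  simp [genAct, shift, hp, hq, Equiv.swap_apply_of_ne_of_ne]

lemma sum_genAct {p q : Fin n} (h : p ≠ q) (i : ℤ) (a : Fin n → ℤ) :
    ∑ r, genAct p q i a r = ∑ r, a r := by
  have h1 : ∀ r, shift p q i r = (if r = q then i else 0) - if r = p then i else 0 := by
    intro r
    unfold shift
    split_ifs <;> simp_all
  simp only [genAct, h1, Finset.sum_add_distrib, Finset.sum_sub_distrib,
    Equiv.sum_comp (Equiv.swap p q) a]
  simp

lemma gen_mul_self (p q : Fin n) (i : ℤ) (h : p ≠ q) : gen p q i * gen p q i = 1 := by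
  rw [gen, monomialMat_mul, ← monomialMat_zero_one, Equiv.swap_mul_self]
  congr 1
  ext r
  simp only [shift, Equiv.swap_apply_def, Pi.zero_apply]
  split_ifs <;> simp_all

lemma gen_inv {p q : Fin n} (i : ℤ) (h : p ≠ q) : (gen p q i)⁻¹ = gen p q i :=
  Matrix.inv_eq_left_inv (gen_mul_self p q i h)

/-- `gen p q i` belongs to the generating set: `p`, `q` are adjacent, and twisting is allowed
only on the first two rows. -/
def IsGenData (p q : Fin n) (i : ℤ) : Prop := q.val = p.val + 1 ∧ (p.val = 0 ∨ i = 0)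

lemma IsGenData.ne {p q : Fin n} {i : ℤ} (h : IsGenData p q i) : p ≠ q := by
  rintro rfl
  have := h.1
  omega

lemma IsGenData.lt {p q : Fin n} {i : ℤ} (h : IsGenData p q i) : p < q := by
  have := h.1
  rw [Fin.lt_def]
  omega

/-- Multiplication by `gen p q i` on the left decreases the weight. -/
def IsDescent (p q : Fin n) (i : ℤ) (a : Fin n → ℤ) (σ : Equiv.Perm (Fin n)) : Prop :=
  (σ p < σ q ∧ a q ≠ 0) ∨ (σ q < σ p ∧ a p + i = 0)

lemma sum_rowPairs_swap {p q : Fin n} (h : q.val = p.val + 1) (g : Fin n → Fin n → ℕ) :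
    ∑ ij ∈ rowPairs n, g (Equiv.swap p q ij.1) (Equiv.swap p q ij.2) + g p q =
      ∑ ij ∈ rowPairs n, g ij.1 ij.2 + g q p := by
  have hpq : (p, q) ∈ rowPairs n := mem_rowPairs.2 (by rw [Fin.lt_def]; simp; omega)
  rw [← Finset.sum_erase_add _ _ hpq, ← Finset.sum_erase_add (rowPairs n) _ hpq]
  simp only [Equiv.swap_apply_left, Equiv.swap_apply_right]
  have key : ∑ ij ∈ (rowPairs n).erase (p, q), g (Equiv.swap p q ij.1) (Equiv.swap p q ij.2) =
      ∑ ij ∈ (rowPairs n).erase (p, q), g ij.1 ij.2 := by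
    refine Finset.sum_equiv (Equiv.prodCongr (Equiv.swap p q) (Equiv.swap p q)) ?_ ?_
    · rintro ⟨i, j⟩
      simp only [Finset.mem_erase, mem_rowPairs, Equiv.prodCongr_apply, Prod.map, ne_eq,
        Prod.mk.injEq, Equiv.swap_apply_def, Fin.lt_def, Fin.ext_iff]
      split_ifs <;> omega
    · simp
  omega

lemma weight_genAct {p q : Fin n} {i : ℤ} (h : IsGenData p q i) (a : Fin n → ℤ)
    (σ : Equiv.Perm (Fin n)) :
    weight (genAct p q i a) (σ * Equiv.swap p q) +
        (if σ q < σ p then 1 else if a q = 0 then 0 else 2)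
      = weight a σ + (if σ p < σ q then 1 else if a p + i = 0 then 0 else 2) := by
  obtain ⟨hpq, hi⟩ := h
  have hne : p ≠ q := by rintro rfl; omega
  have key := sum_rowPairs_swap hpq fun r s =>
    if σ s < σ r then 1 else if a s + (if s = p then i else 0) = 0 then 0 else 2
  have h1 : weight a σ = ∑ ij ∈ rowPairs n, (if σ ij.2 < σ ij.1 then 1 else
      if a ij.2 + (if ij.2 = p then i else 0) = 0 then 0 else 2) := by
    refine Finset.sum_congr rfl ?_
    rintro ⟨r, s⟩ hrs
    rw [mem_rowPairs, Fin.lt_def] at hrs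
    have : (if s = p then i else 0) = 0 := by
      split_ifs with hs
      · subst hs
        exact hi.resolve_left (by simp only at hrs; omega)
      · rfl
    simp only [pairWeight, this, add_zero]
  have h2 : weight (genAct p q i a) (σ * Equiv.swap p q) = ∑ ij ∈ rowPairs n,
      (if σ (Equiv.swap p q ij.2) < σ (Equiv.swap p q ij.1) then 1 else
      if a (Equiv.swap p q ij.2) + (if Equiv.swap p q ij.2 = p then i else 0) = 0
      then 0 else 2) := by
    refine Finset.sum_congr rfl ?_
    rintro ⟨r, s⟩ hrs
    rw [mem_rowPairs, Fin.lt_def] at hrs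
    have : genAct p q i a s = a (Equiv.swap p q s) + if Equiv.swap p q s = p then i else 0 := by
      by_cases hs : s = p
      · subst hs
        have hi0 : i = 0 := hi.resolve_left (by simp only at hrs; omega)
        rw [genAct_left, hi0]
        simp
      · by_cases hs' : s = q
        · subst hs'
          rw [genAct_right hne]
          simp
        · rw [genAct_of_ne hs hs', Equiv.swap_apply_of_ne_of_ne hs hs']
          simp [hs]
    simp only [pairWeight, this, Equiv.Perm.mul_apply]
  rw [h1, h2]
  simpa [hne.symm] using key

lemma weight_genAct_of_isDescent {p q : Fin n} {i : ℤ} (h : IsGenData p q i) {a : Fin n → ℤ}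
    {σ : Equiv.Perm (Fin n)} (hd : IsDescent p q i a σ) :
    weight (genAct p q i a) (σ * Equiv.swap p q) + 1 = weight a σ := by
  have key := weight_genAct h a σ
  rcases hd with ⟨h1, h2⟩ | ⟨h1, h2⟩
  · rw [if_neg h1.not_gt, if_neg h2, if_pos h1] at key
    omega
  · rw [if_pos h1, if_neg h1.not_gt, if_pos h2] at key
    omega

lemma weight_genAct_of_not_isDescent {p q : Fin n} {i : ℤ} (h : IsGenData p q i)
    {a : Fin n → ℤ} {σ : Equiv.Perm (Fin n)} (hd : ¬ IsDescent p q i a σ) :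
    weight (genAct p q i a) (σ * Equiv.swap p q) = weight a σ + 1 := by
  have key := weight_genAct h a σ
  rw [IsDescent, not_or, not_and, not_and, not_not] at hd
  rcases lt_or_gt_of_ne (σ.injective.ne h.ne) with h1 | h1
  · rw [if_neg h1.not_gt, if_pos (hd.1 h1), if_pos h1] at key
    omega
  · rw [if_pos h1, if_neg h1.not_gt, if_neg (hd.2 h1)] at key
    omega

lemma exists_isDescent {a : Fin n → ℤ} {σ : Equiv.Perm (Fin n)} (hw : weight a σ ≠ 0) :
    ∃ p q i, IsGenData p q i ∧ IsDescent p q i a σ := by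
  by_contra! hno
  have step : ∀ p q : Fin n, q.val = p.val + 1 → (p.val = 0 ∨ a p = 0) →
      σ p < σ q ∧ a q = 0 := by
    intro p q hpq hp
    have hdata : IsGenData p q (-a p) := ⟨hpq, by simpa using hp⟩
    have hd := hno p q _ hdata
    rw [IsDescent, not_or, not_and, not_and, not_not] at hd
    have hlt : σ p < σ q := by
      rcases lt_or_gt_of_ne (σ.injective.ne hdata.ne) with h1 | h1
      · exact h1
      · exact absurd (add_neg_cancel (a p)) (hd.2 h1)
    exact ⟨hlt, hd.1 hlt⟩
  have hzero : ∀ m (hm : m < n), m = 0 ∨ a ⟨m, hm⟩ = 0 := by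
    intro m
    induction m with
    | zero => exact fun _ => Or.inl rfl
    | succ m ih => exact fun hm => Or.inr (step ⟨m, by omega⟩ ⟨m + 1, hm⟩ rfl (ih (by omega))).2
  have hmono : ∀ m (hm : m < n) (l) (hl : l < n), l < m → σ ⟨l, hl⟩ < σ ⟨m, hm⟩ := by
    intro m
    induction m with
    | zero => intro _ l _ hlm; omega
    | succ m ih =>
      intro hm l hl hlm
      have h1 := (step ⟨m, by omega⟩ ⟨m + 1, hm⟩ rfl (hzero m (by omega))).1
      rcases (Nat.lt_succ_iff.1 hlm).lt_or_eq with h2 | rfl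
      · exact (ih (by omega) l hl h2).trans h1
      · exact h1
  refine hw (Finset.sum_eq_zero ?_)
  rintro ⟨r, s⟩ hrs
  rw [mem_rowPairs, Fin.lt_def] at hrs
  have h1 := hmono s s.2 r r.2 hrs
  have h2 := (hzero s s.2).resolve_left (by simp only at hrs; omega)
  simp only [pairWeight, if_neg h1.not_gt, if_pos h2]

lemma monomialMat_eq_one_of_weight {a : Fin n → ℤ} {σ : Equiv.Perm (Fin n)}
    (ha : ∑ r, a r = 0) (hw : weight a σ = 0) : monomialMat a σ = 1 := by
  have h : ∀ r s : Fin n, r < s → σ r < σ s ∧ a s = 0 := by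
    intro r s hrs
    have h1 := (Finset.sum_eq_zero_iff.1 hw) (r, s) (mem_rowPairs.2 hrs)
    simp only [pairWeight] at h1
    split_ifs at h1 with h2 h3
    exact ⟨lt_of_le_of_ne (not_lt.1 h2) (σ.injective.ne hrs.ne), h3⟩
  have hσ : σ = 1 := by
    have hm : StrictMono σ := fun r s hrs => (h r s hrs).1
    have := Subsingleton.elim (hm.orderIsoOfSurjective σ σ.surjective) (OrderIso.refl _)
    ext r
    exact congrArg Fin.val (DFunLike.congr_fun this r)
  have hpos : ∀ r : Fin n, 0 < r.val → a r = 0 := by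
    intro r hr
    exact (h ⟨0, by omega⟩ r (by rw [Fin.lt_def]; exact hr)).2
  have ha0 : a = 0 := by
    ext r
    rcases Nat.eq_zero_or_pos r.val with hr | hr
    · rw [Pi.zero_apply, ← ha, Finset.sum_eq_single r]
      · intro s _ hs
        exact hpos s (Nat.pos_of_ne_zero fun h0 => hs (Fin.ext (h0.trans hr.symm)))
      · simp
    · exact hpos r hr
  rw [hσ, ha0, monomialMat_zero_one]

lemma weight_zero_one : weight (0 : Fin n → ℤ) 1 = 0 := by
  refine Finset.sum_eq_zero ?_
  rintro ⟨r, s⟩ hrs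
  rw [mem_rowPairs] at hrs
  simp [pairWeight, hrs.le]

end Monomial

section Generators

variable {n : ℕ}

lemma tMat_eq_gen (hn : 2 ≤ n) (i : ℤ) :
    tMat n i = gen (⟨0, by omega⟩ : Fin n) ⟨1, by omega⟩ i := by
  ext r c
  simp only [tMat, gen, monomialMat, shift, Equiv.swap_apply_def, Fin.ext_iff]
  rcases r with ⟨_ | _ | r, hr⟩ <;> rcases c with ⟨_ | _ | c, hc⟩ <;> simp

lemma sMat_eq_gen {j : ℕ} (hj : 3 ≤ j) (hjn : j ≤ n) :
    sMat n j = gen (⟨j - 2, by omega⟩ : Fin n) ⟨j - 1, by omega⟩ 0 := by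
  ext r c
  simp only [sMat, gen, monomialMat, shift, Equiv.swap_apply_def, Fin.ext_iff, neg_zero, ite_self,
    zpow_zero]
  congr 1
  rw [eq_iff_iff]
  split_ifs <;> simp <;> omega

lemma mem_Xset_iff (hn : 2 ≤ n) {w : Matrix (Fin n) (Fin n) (RatFunc ℚ)} :
    w ∈ Xset n ↔ ∃ p q i, IsGenData p q i ∧ w = gen p q i := by
  constructor
  · rintro (⟨i, rfl⟩ | ⟨j, hj, hjn, rfl⟩)
    · exact ⟨_, _, i, ⟨rfl, Or.inl rfl⟩, tMat_eq_gen hn i⟩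
    · exact ⟨_, _, 0, ⟨by simp only; omega, Or.inr rfl⟩, sMat_eq_gen hj hjn⟩
  · rintro ⟨⟨p, hp⟩, ⟨q, hq⟩, i, ⟨rfl, hi⟩, rfl⟩
    rcases Nat.eq_zero_or_pos p with rfl | hp0
    · exact Or.inl ⟨i, (tMat_eq_gen hn i).symm⟩
    · obtain rfl : i = 0 := hi.resolve_left hp0.ne'
      simp only at hq
      exact Or.inr ⟨p + 2, by omega, by omega, (sMat_eq_gen (j := p + 2) (by omega) (by omega)).symm⟩

lemma exists_monomialMat_of_list (hn : 2 ≤ n) (L : List (Matrix (Fin n) (Fin n) (RatFunc ℚ)))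
    (hL : ∀ w ∈ L, w ∈ Xset n) :
    ∃ a σ, ∑ r, a r = 0 ∧ weight a σ ≤ L.length ∧ L.prod = monomialMat a σ := by
  induction L with
  | nil => exact ⟨0, 1, by simp, by simp [weight_zero_one], by simp [monomialMat_zero_one]⟩
  | cons w L ih =>
    obtain ⟨a, σ, ha, hw, hprod⟩ := ih fun v hv => hL v (List.mem_cons_of_mem _ hv)
    obtain ⟨p, q, i, hd, rfl⟩ := (mem_Xset_iff hn).1 (hL w List.mem_cons_self)
    refine ⟨_, _, (sum_genAct hd.ne i a).trans ha, ?_,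
      by rw [List.prod_cons, hprod, gen_mul_monomialMat]⟩
    by_cases h : IsDescent p q i a σ
    · have := weight_genAct_of_isDescent hd h
      simp only [List.length_cons]
      omega
    · have := weight_genAct_of_not_isDescent hd h
      simp only [List.length_cons]
      omega

lemma exists_list_of_monomialMat (hn : 2 ≤ n) (m : ℕ) (a : Fin n → ℤ) (σ : Equiv.Perm (Fin n))
    (ha : ∑ r, a r = 0) (hm : weight a σ = m) :
    ∃ L : List (Matrix (Fin n) (Fin n) (RatFunc ℚ)),
      L.length = m ∧ (∀ w ∈ L, w ∈ Xset n) ∧ L.prod = monomialMat a σ := by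
  induction m generalizing a σ with
  | zero => exact ⟨[], rfl, by simp, by simp [monomialMat_eq_one_of_weight ha hm]⟩
  | succ m ih =>
    obtain ⟨p, q, i, hd, hdes⟩ := exists_isDescent (a := a) (σ := σ) (by omega)
    have hw := weight_genAct_of_isDescent hd hdes
    obtain ⟨L, hlen, hL, hprod⟩ := ih _ _ ((sum_genAct hd.ne i a).trans ha)
      (show weight (genAct p q i a) (σ * Equiv.swap p q) = m by omega)
    refine ⟨gen p q i :: L, by simp [hlen], ?_, ?_⟩
    · intro w hw
      rcases List.mem_cons.1 hw with rfl | hw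
      · exact (mem_Xset_iff hn).2 ⟨p, q, i, hd, rfl⟩
      · exact hL w hw
    · rw [List.prod_cons, hprod, ← gen_mul_monomialMat, ← mul_assoc, gen_mul_self _ _ _ hd.ne,
        one_mul]

lemma len_monomialMat (hn : 2 ≤ n) {a : Fin n → ℤ} (ha : ∑ r, a r = 0)
    (σ : Equiv.Perm (Fin n)) : len n (monomialMat a σ) = weight a σ := by
  have hmem := exists_list_of_monomialMat hn _ a σ ha rfl
  refine le_antisymm (Nat.sInf_le hmem) (le_csInf ⟨_, hmem⟩ ?_)
  rintro m ⟨L, rfl, hL, hprod⟩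
  obtain ⟨b, τ, -, hw, hprod'⟩ := exists_monomialMat_of_list hn L hL
  obtain ⟨rfl, rfl⟩ := monomialMat_inj (hprod.symm.trans hprod')
  exact hw

lemma exists_monomialMat_of_len_ne_zero (hn : 2 ≤ n) {w : Matrix (Fin n) (Fin n) (RatFunc ℚ)}
    (hw : len n w ≠ 0) : ∃ a σ, ∑ r, a r = 0 ∧ w = monomialMat a σ := by
  obtain ⟨m, L, -, hL, rfl⟩ := Nat.nonempty_of_pos_sInf (Nat.pos_of_ne_zero hw)
  obtain ⟨a, σ, ha, -, h⟩ := exists_monomialMat_of_list hn L hL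
  exact ⟨a, σ, ha, h⟩

lemma gen_eq_genAct {p q : Fin n} (i : ℤ) :
    gen p q i = monomialMat (genAct p q i 0) (1 * Equiv.swap p q) := by
  rw [← gen_mul_monomialMat, monomialMat_zero_one, mul_one]

lemma len_gen (hn : 2 ≤ n) {p q : Fin n} {i : ℤ} (h : IsGenData p q i) :
    len n (gen p q i) = 1 := by
  rw [gen_eq_genAct, len_monomialMat hn ((sum_genAct h.ne i 0).trans (by simp)),
    weight_genAct_of_not_isDescent h, weight_zero_one]
  simp [IsDescent, h.lt.le]

lemma preL_gen_iff (hn : 2 ≤ n) {p q : Fin n} {i : ℤ} (h : IsGenData p q i) {a : Fin n → ℤ}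
    (ha : ∑ r, a r = 0) (σ : Equiv.Perm (Fin n)) :
    preL n (gen p q i) (monomialMat a σ) ↔ IsDescent p q i a σ := by
  rw [preL, gen_inv i h.ne, gen_mul_monomialMat, len_gen hn h, len_monomialMat hn ha,
    len_monomialMat hn ((sum_genAct h.ne i a).trans ha)]
  by_cases hd : IsDescent p q i a σ
  · have := weight_genAct_of_isDescent h hd
    simp only [hd, iff_true]
    omega
  · have := weight_genAct_of_not_isDescent h hd
    simp only [hd, iff_false]
    omega

lemma preL_gen_mul {p q : Fin n} {i : ℤ} (h : IsGenData p q i)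
    {m z : Matrix (Fin n) (Fin n) (RatFunc ℚ)} (hm : preL n (gen p q i) (gen p q i * m))
    (hz : preL n (gen p q i) z) (hmz : preL n m (gen p q i * z)) :
    preL n (gen p q i * m) z := by
  simp only [preL, Matrix.mul_inv_rev, gen_inv i h.ne, ← mul_assoc, gen_mul_self p q i h.ne,
    one_mul] at *
  rw [mul_assoc]
  rw [mul_assoc] at hmz
  omega

end Generators

section Interval

variable {n : ℕ}

/-- Row exponents of `λ ^ k`. -/
def lamExp (n : ℕ) (k : ℤ) (r : Fin n) : ℤ := if r.val = 0 then k * (-((n : ℤ) - 1)) else k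

lemma lam_zpow (k : ℤ) : lam n ^ k = monomialMat (lamExp n k) 1 := by
  have h1 : lam n = monomialMat (lamExp n 1) 1 := by
    ext r c
    by_cases hrc : r = c
    · subst hrc
      by_cases hr : r.val = 0 <;> simp [lam, monomialMat, lamExp, hr]
    · simp [lam, monomialMat, hrc]
  have hnat : ∀ m : ℕ, lam n ^ m = monomialMat (lamExp n m) 1 := by
    intro m
    induction m with
    | zero =>
      rw [pow_zero, ← monomialMat_zero_one]
      congr 1
      ext r
      simp [lamExp]
    | succ m ih =>
      rw [pow_succ, ih, h1, monomialMat_mul, mul_one]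
      congr 1
      ext r
      simp only [lamExp, Equiv.Perm.one_apply]
      by_cases hr : r.val = 0
      · simp only [hr, if_true]
        push_cast
        ring
      · simp only [hr, if_false]
        push_cast
        ring
  cases k with
  | ofNat m => exact (zpow_natCast _ m).trans (hnat m)
  | negSucc m =>
    rw [zpow_negSucc, hnat, monomialMat_inv, inv_one]
    congr 1
    ext r
    simp only [lamExp, Equiv.Perm.one_apply, Int.negSucc_eq]
    by_cases hr : r.val = 0
    · simp only [hr, if_true]
      push_cast
      ring
    · simp only [hr, if_false]
      push_cast
      ring

lemma sum_lamExp (hn : 2 ≤ n) (k : ℤ) : ∑ r, lamExp n k r = 0 := by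
  obtain ⟨m, rfl⟩ : ∃ m, n = m + 1 := ⟨n - 1, by omega⟩
  rw [Fin.sum_univ_succ]
  simp [lamExp]
  ring

lemma weight_lamExp {k : ℤ} (hk : k ≠ 0) :
    weight (lamExp n k) 1 = ∑ _ij ∈ rowPairs n, 2 := by
  refine Finset.sum_congr rfl ?_
  rintro ⟨r, s⟩ hrs
  rw [mem_rowPairs] at hrs
  have hs : s.val ≠ 0 := by
    rw [Fin.lt_def] at hrs
    simp only at hrs
    omega
  simp [pairWeight, lamExp, hrs.not_gt, hs, hk]

lemma weight_lamExp_ne_zero (hn : 2 ≤ n) {k : ℤ} (hk : k ≠ 0) :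
    weight (lamExp n k) 1 ≠ 0 := by
  rw [weight_lamExp hk]
  intro h
  have := (Finset.sum_eq_zero_iff.1 h) (⟨0, by omega⟩, ⟨1, by omega⟩)
    (mem_rowPairs.2 (by simp [Fin.lt_def]))
  omega

lemma weight_reindex (b : Fin n → ℤ) (σ : Equiv.Perm (Fin n)) :
    weight (fun r => b (σ⁻¹ r)) σ⁻¹ = ∑ ij ∈ rowPairs n,
      if σ ij.2 < σ ij.1 then 1 else if b ij.2 = 0 then 0 else 2 := by
  have hl : weight (fun r => b (σ⁻¹ r)) σ⁻¹ = ∑ i, ∑ j, if σ i < σ j then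
      (if j < i then 1 else if b j = 0 then 0 else 2) else 0 := by
    rw [weight, rowPairs, Finset.sum_filter, Fintype.sum_prod_type,
      ← Equiv.sum_comp σ]
    refine Finset.sum_congr rfl fun i _ => ?_
    rw [← Equiv.sum_comp σ]
    simp [pairWeight]
  have hsplit : ∀ i j : Fin n, (if σ i < σ j then
      (if j < i then 1 else if b j = 0 then 0 else 2) else 0) =
      (if σ i < σ j ∧ j < i then 1 else 0) +
      (if i < j ∧ σ i < σ j then (if b j = 0 then 0 else 2) else 0) := by
    intro i j
    rcases lt_trichotomy i j with h | rfl | h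
    · by_cases h' : σ i < σ j <;> simp [h, h', h.not_gt]
    · simp
    · by_cases h' : σ i < σ j <;> simp [h, h', h.not_gt]
  have hr : (∑ ij ∈ rowPairs n, if σ ij.2 < σ ij.1 then 1 else if b ij.2 = 0 then 0 else 2) =
      ∑ i, ∑ j, ((if σ j < σ i ∧ i < j then 1 else 0) +
      (if i < j ∧ σ i < σ j then (if b j = 0 then 0 else 2) else 0)) := by
    rw [rowPairs, Finset.sum_filter, Fintype.sum_prod_type]
    refine Finset.sum_congr rfl fun i _ => Finset.sum_congr rfl fun j _ => ?_
    by_cases h : i < j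
    · rcases lt_or_gt_of_ne (σ.injective.ne h.ne) with h1 | h1 <;> simp [h, h1, h1.not_gt]
    · simp [h]
  rw [hl, hr]
  simp only [hsplit, Finset.sum_add_distrib]
  congr 1
  exact Finset.sum_comm

lemma exists_of_mem_intervalL (hn : 2 ≤ n) {k : ℤ} (hk : k ≠ 0)
    {z : Matrix (Fin n) (Fin n) (RatFunc ℚ)} (hz : z ∈ intervalL n k) :
    ∃ a σ, ∑ r, a r = 0 ∧ z = monomialMat a σ ∧
      ∀ i j, i < j → σ i < σ j → a j = 0 ∨ a j = k := by
  have hlam : len n (lam n ^ k) = weight (lamExp n k) 1 := by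
    rw [lam_zpow, len_monomialMat hn (sum_lamExp hn k)]
  have hpre : len n z + len n (z⁻¹ * lam n ^ k) = weight (lamExp n k) 1 := hlam ▸ hz
  have hex : ∃ a σ, z = monomialMat a σ ∧ ∑ r, a r = 0 := by
    by_cases h0 : len n z = 0
    · have h1 : len n (z⁻¹ * lam n ^ k) ≠ 0 := by
        have := weight_lamExp_ne_zero hn hk
        omega
      obtain ⟨b, τ, hb, hbz⟩ := exists_monomialMat_of_len_ne_zero hn h1
      have hdet : IsUnit z.det := by
        rw [← Matrix.isUnit_nonsing_inv_det_iff]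
        have := isUnit_det_monomialMat b τ
        rw [← hbz, Matrix.det_mul] at this
        exact isUnit_of_mul_isUnit_left this
      have hz' : z = lam n ^ k * (monomialMat b τ)⁻¹ := by
        rw [← hbz, Matrix.mul_inv_rev, Matrix.nonsing_inv_nonsing_inv z hdet, ← mul_assoc,
          Matrix.mul_nonsing_inv, one_mul]
        rw [lam_zpow]
        exact isUnit_det_monomialMat _ _
      rw [lam_zpow, monomialMat_inv, monomialMat_mul] at hz'
      refine ⟨_, _, hz', ?_⟩
      simp only [Equiv.Perm.one_apply, Finset.sum_add_distrib, Finset.sum_neg_distrib,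
        sum_lamExp hn, Equiv.sum_comp τ⁻¹ b, hb, neg_zero, add_zero]
    · obtain ⟨a, σ, ha, rfl⟩ := exists_monomialMat_of_len_ne_zero hn h0
      exact ⟨a, σ, rfl, ha⟩
  obtain ⟨a, σ, rfl, ha⟩ := hex
  refine ⟨a, σ, ha, rfl, ?_⟩
  have hquot : (monomialMat a σ)⁻¹ * lam n ^ k =
      monomialMat (fun r => (lamExp n k - a) (σ⁻¹ r)) σ⁻¹ := by
    rw [lam_zpow, monomialMat_inv, monomialMat_mul, one_mul]
    congr 1
    ext r
    simp
    ring
  rw [hquot, len_monomialMat hn ha, len_monomialMat hn (by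
      rw [Equiv.sum_comp σ⁻¹ (lamExp n k - a)]
      simp [Finset.sum_sub_distrib, sum_lamExp hn, ha]), weight_reindex, weight,
    ← Finset.sum_add_distrib, weight_lamExp hk] at hpre
  have hlamExp : ∀ i j : Fin n, i < j → lamExp n k j = k := by
    intro i j hij
    rw [Fin.lt_def] at hij
    exact if_neg (by omega)
  have hall := (Finset.sum_eq_sum_iff_of_le (by
    rintro ⟨i, j⟩ hij
    rw [mem_rowPairs] at hij
    simp only [pairWeight, Pi.sub_apply, hlamExp i j hij]
    split_ifs <;> omega)).1 hpre.symm
  intro i j hij hσ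
  have h := hall (i, j) (mem_rowPairs.2 hij)
  simp only [pairWeight, Pi.sub_apply, hlamExp i j hij, if_neg hσ.not_gt] at h
  split_ifs at h <;> omega

lemma IsLubL.symm {k : ℤ} {u v m : Matrix (Fin n) (Fin n) (RatFunc ℚ)} (h : IsLubL n k u v m) :
    IsLubL n k v u m :=
  ⟨h.1, h.2.2.1, h.2.1, fun z hz hv hu => h.2.2.2 z hz hu hv⟩

lemma isDescent_lamExp {k : ℤ} (hk : k ≠ 0) {p q : Fin n} {i : ℤ} (h : IsGenData p q i) :
    IsDescent p q i (lamExp n k) 1 := by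
  refine Or.inl ⟨h.lt, ?_⟩
  rw [lamExp, if_neg]
  · exact hk
  · have := h.1
    omega

/-- It suffices to check divisibility by a least upper bound of two generators on the
monomial matrices satisfying the exponent condition that characterizes `[1, λ ^ k]`. -/
lemma isLubL_gen (hn : 2 ≤ n) {k : ℤ} (hk : k ≠ 0) {p q p' q' : Fin n} {i i' : ℤ}
    (h : IsGenData p q i) (h' : IsGenData p' q' i')
    {b : Fin n → ℤ} {τ : Equiv.Perm (Fin n)} (hb : ∑ r, b r = 0)
    (hd : IsDescent p q i b τ) (hd' : IsDescent p' q' i' b τ)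
    (hm : ∀ a σ, ∑ r, a r = 0 → (∀ r s, r < s → σ r < σ s → a s = 0 ∨ a s = k) →
      IsDescent p q i a σ → IsDescent p' q' i' a σ →
      preL n (monomialMat b τ) (monomialMat a σ)) :
    IsLubL n k (gen p q i) (gen p' q' i') (monomialMat b τ) := by
  refine ⟨?_, (preL_gen_iff hn h hb τ).2 hd, (preL_gen_iff hn h' hb τ).2 hd', ?_⟩
  · change preL n _ (lam n ^ k)
    rw [lam_zpow]
    refine hm _ _ (sum_lamExp hn k) ?_ (isDescent_lamExp hk h) (isDescent_lamExp hk h')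
    intro r s hrs _
    rw [Fin.lt_def] at hrs
    exact Or.inr (if_neg (by omega))
  · intro z hz hu hv
    obtain ⟨a, σ, ha, rfl, hint⟩ := exists_of_mem_intervalL hn hk hz
    exact hm a σ ha hint ((preL_gen_iff hn h ha σ).1 hu) ((preL_gen_iff hn h' ha σ).1 hv)

lemma gen_eq_monomialMat (p q : Fin n) (i : ℤ) :
    gen p q i = monomialMat (shift p q i) (Equiv.swap p q) := rfl

lemma sum_shift {p q : Fin n} (h : p ≠ q) (i : ℤ) : ∑ r, shift p q i r = 0 := by
  simpa [genAct] using sum_genAct h i 0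

lemma preL_gen_mul_gen (hn : 2 ≤ n) {p q p' q' : Fin n} {i i' : ℤ}
    (h : IsGenData p q i) (h' : IsGenData p' q' i')
    (hd : IsDescent p q i (genAct p q i (shift p' q' i')) (Equiv.swap p' q' * Equiv.swap p q))
    {a : Fin n → ℤ} {σ : Equiv.Perm (Fin n)} (ha : ∑ r, a r = 0) (h1 : IsDescent p q i a σ)
    (h2 : IsDescent p' q' i' (genAct p q i a) (σ * Equiv.swap p q)) :
    preL n (gen p q i * gen p' q' i') (monomialMat a σ) := by
  refine preL_gen_mul h ?_ ((preL_gen_iff hn h ha σ).2 h1) ?_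
  · rw [gen_eq_monomialMat p' q', gen_mul_monomialMat, preL_gen_iff hn h]
    · exact hd
    · exact (sum_genAct h.ne i _).trans (sum_shift h'.ne i')
  · rw [gen_mul_monomialMat, preL_gen_iff hn h' ((sum_genAct h.ne i a).trans ha)]
    exact h2

/-- Two distinct generators acting on the same pair of rows. -/
lemma isLubL_gen_same (hn : 2 ≤ n) {k : ℤ} (hk : k ≠ 0) {p q : Fin n} {i j : ℤ} (hij : i ≠ j)
    (h : IsGenData p q i) (h' : IsGenData p q j) :
    IsLubL n k (gen p q i) (gen p q j) (gen p q i * gen p q (i - k)) := by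
  have hp : p.val = 0 := by
    have := h.2
    have := h'.2
    omega
  have h'' : IsGenData p q (i - k) := ⟨h.1, Or.inl hp⟩
  rw [gen_eq_monomialMat p q (i - k), gen_mul_monomialMat]
  refine isLubL_gen hn hk h h' ((sum_genAct h.ne i _).trans (sum_shift h.ne _)) ?_ ?_ ?_
  · left
    simp [genAct_right h.ne, shift, h.lt, hk]
  · left
    simp [genAct_right h.ne, shift, h.lt, hk]
  · intro a σ ha hint hd hd'
    rw [← gen_mul_monomialMat, ← gen_eq_monomialMat]
    refine preL_gen_mul_gen hn h h'' ?_ ha hd ?_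
    · left
      simp [genAct_right h.ne, shift, h.lt, hk]
    · have hlt : σ p < σ q ∧ a q ≠ 0 := by
        rcases hd with hd | hd
        · exact hd
        · rcases hd' with hd' | hd'
          · exact hd'
          · omega
      have hq := (hint p q h.lt hlt.1).resolve_left hlt.2
      right
      simp [genAct_left, hlt.1, hq]

/-- Two generators acting on disjoint pairs of rows commute. -/
lemma gen_mul_gen_comm {p q p' q' : Fin n} (i : ℤ) (hpp : p ≠ p') (hpq : p ≠ q')
    (hqp : q ≠ p') (hqq : q ≠ q') (i' : ℤ) :
    gen p q i * gen p' q' i' = gen p' q' i' * gen p q i := by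
  rw [gen, gen, monomialMat_mul, monomialMat_mul]
  congr 1
  · ext r
    simp only [shift, Equiv.swap_apply_def]
    grind
  · ext r
    simp only [Equiv.Perm.mul_apply, Equiv.swap_apply_def]
    grind

lemma isLubL_gen_comm (hn : 2 ≤ n) {k : ℤ} (hk : k ≠ 0) {p q p' q' : Fin n} {i i' : ℤ}
    (h : IsGenData p q i) (h' : IsGenData p' q' i') (hpp : p ≠ p') (hpq : p ≠ q')
    (hqp : q ≠ p') (hqq : q ≠ q') :
    IsLubL n k (gen p q i) (gen p' q' i') (gen p q i * gen p' q' i') := by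
  have hd : IsDescent p q i (genAct p q i (shift p' q' i'))
      (Equiv.swap p' q' * Equiv.swap p q) := by
    right
    simp [genAct_left, shift, Equiv.swap_apply_of_ne_of_ne, hpp, hpq, hqp, hqq, h.lt]
  rw [gen_eq_monomialMat p' q' i', gen_mul_monomialMat]
  refine isLubL_gen hn hk h h' ((sum_genAct h.ne i _).trans (sum_shift h'.ne _)) hd ?_ ?_
  · right
    simp [genAct_of_ne, shift, Equiv.swap_apply_of_ne_of_ne, hpp.symm, hpq.symm, hqp.symm,
      hqq.symm, h'.lt]
  · intro a σ ha hint h1 h2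
    rw [← gen_mul_monomialMat, ← gen_eq_monomialMat]
    refine preL_gen_mul_gen hn h h' hd ha h1 ?_
    simpa [IsDescent, genAct_of_ne, Equiv.swap_apply_of_ne_of_ne, hpp.symm, hpq.symm, hqp.symm,
      hqq.symm] using h2

lemma gen_braid {p q r : Fin n} (i : ℤ) (hpq : p ≠ q) (hpr : p ≠ r) (hqr : q ≠ r) :
    gen p q i * gen q r 0 * gen p q i = gen q r 0 * gen p q i * gen q r 0 := by
  simp only [gen, monomialMat_mul]
  congr 1
  · ext x
    simp only [shift, Equiv.swap_apply_def, Equiv.Perm.mul_apply, neg_zero, ite_self]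
    grind
  · ext x
    simp only [Equiv.Perm.mul_apply, Equiv.swap_apply_def]
    grind

lemma isLubL_gen_braid (hn : 2 ≤ n) {k : ℤ} (hk : k ≠ 0) {p q r : Fin n} {i : ℤ}
    (h : IsGenData p q i) (h' : IsGenData q r 0) :
    IsLubL n k (gen p q i) (gen q r 0) (gen p q i * gen q r 0 * gen p q i) := by
  have hpq := h.ne
  have hqr := h'.ne
  have hlt := h.lt
  have hlt' := h'.lt
  have hpr : p ≠ r := (hlt.trans hlt').ne
  have hs : ∑ x, genAct q r 0 (shift p q i) x = 0 := (sum_genAct hqr 0 _).trans (sum_shift hpq i)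
  have hd : IsDescent p q i (genAct p q i (genAct q r 0 (shift p q i)))
      (Equiv.swap p q * Equiv.swap q r * Equiv.swap p q) := by
    right
    simp [genAct_left, shift, Equiv.swap_apply_of_ne_of_ne, hpq, hpr, hpr.symm, hqr.symm,
      hlt']
  have heq : gen p q i * gen q r 0 * gen p q i =
      monomialMat (genAct p q i (genAct q r 0 (shift p q i)))
        (Equiv.swap p q * Equiv.swap q r * Equiv.swap p q) := by
    rw [← gen_mul_monomialMat, ← gen_mul_monomialMat, mul_assoc]
    rfl
  rw [heq]
  refine isLubL_gen hn hk h h' ((sum_genAct hpq i _).trans hs) hd ?_ ?_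
  · right
    simp [genAct_right, genAct_of_ne, shift, Equiv.swap_apply_of_ne_of_ne, hpq, hpr,
      hpr.symm, hqr.symm, hlt]
  · intro a σ ha hint h1 h2
    rw [← heq, mul_assoc]
    have hσpq := σ.injective.ne hpq
    have hσpr := σ.injective.ne hpr
    have hσqr := σ.injective.ne hqr
    clear hint
    refine preL_gen_mul h ?_ ((preL_gen_iff hn h ha σ).2 h1) ?_
    · rw [← mul_assoc, heq, preL_gen_iff hn h ((sum_genAct hpq i _).trans hs)]
      exact hd
    · rw [gen_mul_monomialMat]
      refine preL_gen_mul_gen hn h' h ?_ ((sum_genAct hpq i a).trans ha) ?_ ?_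
      · right
        simp [genAct_left, shift, Equiv.swap_apply_of_ne_of_ne, hpr.symm, hqr.symm,
          hlt.trans hlt']
      · simp only [IsDescent, Equiv.Perm.mul_apply, Equiv.swap_apply_right,
          Equiv.swap_apply_of_ne_of_ne hpr.symm hqr.symm, genAct_right hpq,
          genAct_of_ne hpr.symm hqr.symm] at h1 h2 ⊢
        clear hd heq
        generalize σ p = u, σ q = v, σ r = w at *
        grind
      · simp only [IsDescent, Equiv.Perm.mul_apply,
          Equiv.swap_apply_left, Equiv.swap_apply_of_ne_of_ne hpr.symm hqr.symm,
          Equiv.swap_apply_of_ne_of_ne hpq hpr, genAct_left,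
          genAct_of_ne hpq hpr, genAct_of_ne hpr.symm hqr.symm] at h1 h2 ⊢
        clear hd heq
        generalize σ p = u, σ q = v, σ r = w at *
        grind

end Interval

lemma exists_isLubL_gen {n : ℕ} (hn : 2 ≤ n) {k : ℤ} (hk : k ≠ 0) {p q p' q' : Fin n} {i i' : ℤ}
    (h : IsGenData p q i) (h' : IsGenData p' q' i') (hne : gen p q i ≠ gen p' q' i') :
    ∃ m, IsLubL n k (gen p q i) (gen p' q' i') m := by
  wlog hle : p ≤ p' generalizing p q p' q' i i'
  · obtain ⟨m, hm⟩ := this h' h hne.symm (not_le.1 hle).le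
    exact ⟨m, hm.symm⟩
  have hq := h.1
  have hq' := h'.1
  rw [Fin.le_def] at hle
  rcases hle.eq_or_lt with h1 | h1
  · obtain rfl : p = p' := Fin.ext h1
    obtain rfl : q = q' := Fin.ext (by omega)
    exact ⟨_, isLubL_gen_same hn hk (fun hi => hne (by rw [hi])) h h'⟩
  · rcases (Nat.succ_le_of_lt h1).eq_or_lt with h2 | h2
    · obtain rfl : q = p' := Fin.ext (by omega)
      obtain rfl : i' = 0 := h'.2.resolve_left (by omega)
      exact ⟨_, isLubL_gen_braid hn hk h h'⟩
    · exact ⟨_, isLubL_gen_comm hn hk h h' (by rw [ne_eq, Fin.ext_iff]; omega)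
        (by rw [ne_eq, Fin.ext_iff]; omega) (by rw [ne_eq, Fin.ext_iff]; omega)
        (by rw [ne_eq, Fin.ext_iff]; omega)⟩

/-- least common multiples of pairs of distinct generators in
`([1,λ^k], ⪯)`, given by the explicit formulas of Proposition 5.1. -/
theorem stmt_6 (n : ℕ) (hn : 2 ≤ n) (k : ℤ) (hk : k ≠ 0) :
    (∀ u ∈ Xset n, ∀ v ∈ Xset n, u ≠ v → ∃ m, IsLubL n k u v m) ∧
    (∀ i j : ℤ, i ≠ j →
      IsLubL n k (tMat n i) (tMat n j) (tMat n i * tMat n (i - k)) ∧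
      tMat n i * tMat n (i - k) = tMat n j * tMat n (j - k)) ∧
    (3 ≤ n → ∀ i : ℤ,
      IsLubL n k (tMat n i) (sMat n 3) (tMat n i * sMat n 3 * tMat n i) ∧
      tMat n i * sMat n 3 * tMat n i = sMat n 3 * tMat n i * sMat n 3) ∧
    (∀ i : ℤ, ∀ j : ℕ, 4 ≤ j → j ≤ n →
      IsLubL n k (tMat n i) (sMat n j) (tMat n i * sMat n j) ∧
      tMat n i * sMat n j = sMat n j * tMat n i) ∧
    (∀ i : ℕ, 3 ≤ i → i + 1 ≤ n →
      IsLubL n k (sMat n i) (sMat n (i + 1)) (sMat n i * sMat n (i + 1) * sMat n i) ∧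
      sMat n i * sMat n (i + 1) * sMat n i = sMat n (i + 1) * sMat n i * sMat n (i + 1)) ∧
    (∀ i j : ℕ, 3 ≤ i → 3 ≤ j → i ≤ n → j ≤ n → (i + 1 < j ∨ j + 1 < i) →
      IsLubL n k (sMat n i) (sMat n j) (sMat n i * sMat n j) ∧
      sMat n i * sMat n j = sMat n j * sMat n i) := by
  refine ⟨?_, ?_, ?_, ?_, ?_, ?_⟩
  · intro u hu v hv huv
    obtain ⟨p, q, i, h, rfl⟩ := (mem_Xset_iff hn).1 hu
    obtain ⟨p', q', i', h', rfl⟩ := (mem_Xset_iff hn).1 hv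
    exact exists_isLubL_gen hn hk h h' huv
  · intro i j hij
    simp only [tMat_eq_gen hn]
    refine ⟨isLubL_gen_same hn hk hij ⟨rfl, Or.inl rfl⟩ ⟨rfl, Or.inl rfl⟩, ?_⟩
    rw [gen, gen, gen, gen, monomialMat_mul, monomialMat_mul]
    congr 1
    ext r
    simp only [shift, Equiv.swap_apply_def]
    grind
  · intro h3 i
    rw [tMat_eq_gen hn, sMat_eq_gen le_rfl h3]
    exact ⟨isLubL_gen_braid hn hk ⟨rfl, Or.inl rfl⟩ ⟨rfl, Or.inr rfl⟩,
      gen_braid i (by simp) (by simp) (by simp)⟩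
  · intro i j hj hjn
    rw [tMat_eq_gen hn, sMat_eq_gen (by omega) hjn]
    refine ⟨isLubL_gen_comm hn hk ⟨rfl, Or.inl rfl⟩ ⟨by simp only; omega, Or.inr rfl⟩ ?_ ?_ ?_ ?_,
      gen_mul_gen_comm i ?_ ?_ ?_ ?_ 0⟩ <;> rw [ne_eq, Fin.ext_iff] <;> simp only <;> omega
  · intro i hi hin
    obtain ⟨p, rfl⟩ : ∃ p, i = p + 2 := ⟨i - 2, by omega⟩
    rw [sMat_eq_gen hi (by omega), sMat_eq_gen (by omega) hin]
    exact ⟨isLubL_gen_braid hn hk ⟨rfl, Or.inr rfl⟩ ⟨rfl, Or.inr rfl⟩,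
      gen_braid 0 (by simp) (by simp) (by simp)⟩
  · intro i j hi hj hin hjn hij
    rw [sMat_eq_gen hi hin, sMat_eq_gen hj hjn]
    refine ⟨isLubL_gen_comm hn hk ⟨by simp only; omega, Or.inr rfl⟩
      ⟨by simp only; omega, Or.inr rfl⟩ ?_ ?_ ?_ ?_,
      gen_mul_gen_comm 0 ?_ ?_ ?_ ?_ 0⟩ <;> rw [ne_eq, Fin.ext_iff] <;> simp only <;> omega
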